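/- Let 2 < p < ∞ and let f be an integrable function on the circle (identified with [0,1)) with Fourier coefficients f̂(n) = ∫_0^1 f(x) e^{−2πinx} dx for n ∈ ℤ. Let (b_j^*)_{j≥1} denote the decreasing rearrangement of the sequence (|f̂(n)|)_{n∈ℤ}, i.e. b_j^* is the j-th largest value among {|f̂(n)| : n ∈ ℤ}. Then ( Σ_{n=1}^∞ ( Σ_{j=1}^n (b_j^*)² )^{p/2} · ( n · log^{p/2}(n+1) )^{−1} )^{1/p} ≤ K(p) · ‖f‖_{L^{2,p}}, where ‖f‖_{L^{2,p}} = ( ∫_0^1 ( t^{1/2} f^{**}(t) )^p dt/t )^{1/p} with f^{**}(t) = (1/t)∫_0^t f^*(s) ds, f^* being the decreasing rearrangement of |f| on (0,1), and K(p) depends only on p. -/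

import Mathlib

open MeasureTheory ENNReal Set

noncomputable section

/-- `enn f x = |f x|` as an extended nonnegative real number. -/
def enn {α : Type*} (f : α → ℂ) : α → ℝ≥0∞ := fun x => ENNReal.ofReal ‖f x‖

/-- Decreasing rearrangement of an `ℝ≥0∞`-valued function. -/
def rearr {α : Type*} [MeasurableSpace α] (μ : Measure α) (h : α → ℝ≥0∞) (t : ℝ) : ℝ≥0∞ :=
  sInf {l : ℝ≥0∞ | μ {x | l < h x} ≤ ENNReal.ofReal t}

/-- Fourier coefficients of an integrable function on the circle `[0,1)`. -/
def fc (f : ℝ → ℂ) (n : ℤ) : ℂ :=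
  ∫ x in Ico (0:ℝ) 1, f x * Complex.exp (((-2 * Real.pi * ((n : ℝ) * x) : ℝ) : ℂ) * Complex.I)

/-- The `(j+1)`-th largest value of a sequence `a : ℤ → ℝ≥0∞` (so `seqRearr a 0` is the largest):
`inf {λ : #{n : a n > λ} ≤ j}`. -/
def seqRearr (a : ℤ → ℝ≥0∞) (j : ℕ) : ℝ≥0∞ :=
  sInf {l : ℝ≥0∞ | Measure.count {n : ℤ | l < a n} ≤ (j : ℝ≥0∞)}

/-- `f^*`, the decreasing rearrangement of `f` on `(0,1)`. -/
def circRearr (f : ℝ → ℂ) : ℝ → ℝ≥0∞ :=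
  rearr (volume.restrict (Ico (0:ℝ) 1)) (enn f)

/-- `f^{**}(t) = (1/t) ∫_0^t f^*`. -/
def circMaxRearr (f : ℝ → ℂ) (t : ℝ) : ℝ≥0∞ :=
  (ENNReal.ofReal t)⁻¹ * ∫⁻ s in Ioo (0:ℝ) t, circRearr f s

/-- The Lorentz norm `‖f‖_{L^{2,p}} = (∫_0^1 (t^{1/2} f^{**}(t))^p dt/t)^{1/p}`. -/
def lorentz2 (p : ℝ) (f : ℝ → ℂ) : ℝ≥0∞ :=
  (∫⁻ t in Ioo (0:ℝ) 1,
      (ENNReal.ofReal (t ^ ((1:ℝ) / 2)) * circMaxRearr f t) ^ p * (ENNReal.ofReal t)⁻¹) ^ (1 / p)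

section Rearrangement

variable {α : Type*} [MeasurableSpace α] {μ : Measure α} {h : α → ℝ≥0∞}

lemma lt_rearr_iff {l : ℝ≥0∞} {t : ℝ} :
    l < rearr μ h t ↔ ENNReal.ofReal t < μ {x | l < h x} := by
  constructor
  · intro hl
    by_contra! hle
    exact absurd (sInf_le hle : rearr μ h t ≤ l) (not_le.2 hl)
  · intro hl
    have hl_top : l < ⊤ := by
      by_contra! htop
      simp [top_le_iff.1 htop] at hl
    obtain ⟨u, hu, hmem, hlim⟩ := exists_seq_strictAnti_tendsto' hl_top
    have hunion : {x | l < h x} = ⋃ k, {x | u k < h x} := by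
      ext x
      simp only [mem_ofPred_eq, mem_iUnion]
      exact ⟨fun hx => (hlim.eventually_lt_const hx).exists, fun ⟨k, hk⟩ => (hmem k).1.trans hk⟩
    have hmono : Monotone fun k => {x | u k < h x} := fun a b hab x hx =>
      (hu.antitone hab).trans_lt hx
    rw [hunion, hmono.measure_iUnion, lt_iSup_iff] at hl
    obtain ⟨k, hk⟩ := hl
    refine (hmem k).1.trans_le (le_sInf fun m hm => ?_)
    by_contra! hmk
    exact absurd (hk.trans_le ((measure_mono fun x hx => hmk.trans hx).trans hm)) (lt_irrefl _)

lemma rearr_antitone : Antitone (rearr μ h) := fun _ _ hst =>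
  sInf_le_sInf fun _ hl => le_trans hl (ENNReal.ofReal_le_ofReal hst)

lemma map_rearr [IsProbabilityMeasure μ] (hh : Measurable h) :
    (volume.restrict (Ioo (0 : ℝ) 1)).map (rearr μ h) = μ.map h := by
  have : IsFiniteMeasure ((volume.restrict (Ioo (0 : ℝ) 1)).map (rearr μ h)) := by
    infer_instance
  have hIoi (l : ℝ≥0∞) :
      (volume.restrict (Ioo (0 : ℝ) 1)).map (rearr μ h) (Ioi l) = μ.map h (Ioi l) := by
    rw [Measure.map_apply rearr_antitone.measurable measurableSet_Ioi,
      Measure.map_apply hh measurableSet_Ioi,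
      Measure.restrict_apply (rearr_antitone.measurable measurableSet_Ioi)]
    have hne : μ (h ⁻¹' Ioi l) ≠ ⊤ := measure_ne_top _ _
    have hle : (μ (h ⁻¹' Ioi l)).toReal ≤ 1 := by
      simpa using ENNReal.toReal_mono one_ne_top (prob_le_one (μ := μ) (s := h ⁻¹' Ioi l))
    have hset : rearr μ h ⁻¹' Ioi l ∩ Ioo 0 1 = Ioo 0 (μ (h ⁻¹' Ioi l)).toReal := by
      ext s
      simp only [mem_inter_iff, mem_preimage, mem_Ioi, lt_rearr_iff, mem_Ioo]
      change ENNReal.ofReal s < μ (h ⁻¹' Ioi l) ∧ _ ↔ _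
      constructor
      · rintro ⟨hs, hs0, -⟩
        exact ⟨hs0, (ENNReal.ofReal_lt_iff_lt_toReal hs0.le hne).1 hs⟩
      · rintro ⟨hs0, hs⟩
        exact ⟨(ENNReal.ofReal_lt_iff_lt_toReal hs0.le hne).2 hs, hs0, hs.trans_le hle⟩
    rw [hset, Real.volume_Ioo, sub_zero, ENNReal.ofReal_toReal hne]
  refine Measure.ext_of_Iic _ _ fun l => ?_
  have huniv : (volume.restrict (Ioo (0 : ℝ) 1)).map (rearr μ h) univ = μ.map h univ := by
    rw [Measure.map_apply rearr_antitone.measurable .univ, Measure.map_apply hh .univ]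
    simp
  have : IsFiniteMeasure (μ.map h) := by infer_instance
  rw [← compl_Ioi, measure_compl measurableSet_Ioi (measure_ne_top _ _),
    measure_compl measurableSet_Ioi (measure_ne_top _ _), hIoi, huniv]

lemma lintegral_comp_rearr [IsProbabilityMeasure μ] (hh : Measurable h) {Φ : ℝ≥0∞ → ℝ≥0∞}
    (hΦ : Measurable Φ) :
    ∫⁻ s in Ioo (0 : ℝ) 1, Φ (rearr μ h s) = ∫⁻ x, Φ (h x) ∂μ := by
  rw [← lintegral_map hΦ rearr_antitone.measurable, map_rearr hh, lintegral_map hΦ hh]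

lemma lintegral_indicator_gt_rearr_le [IsProbabilityMeasure μ] (hh : Measurable h) (t : ℝ) :
    ∫⁻ x, (Ioi (rearr μ h t)).indicator id (h x) ∂μ ≤ ∫⁻ s in Ioo (0 : ℝ) t, rearr μ h s := by
  rw [← lintegral_comp_rearr hh (measurable_id.indicator measurableSet_Ioi),
    ← lintegral_indicator measurableSet_Ioo, ← lintegral_indicator measurableSet_Ioo]
  refine lintegral_mono fun s => ?_
  by_cases hs : s ∈ Ioo (0 : ℝ) 1
  · rw [indicator_of_mem hs]
    by_cases hlt : rearr μ h t < rearr μ h s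
    · have hst : s < t := lt_of_not_ge fun hts => (rearr_antitone hts).not_gt hlt
      rw [indicator_of_mem (show s ∈ Ioo 0 t from ⟨hs.1, hst⟩)]
      exact indicator_le_self _ _ _
    · rw [indicator_of_notMem (show rearr μ h s ∉ Ioi (rearr μ h t) from hlt)]
      exact zero_le
  · simp [indicator_of_notMem hs]

lemma lintegral_indicator_le_rearr_sq_le [IsProbabilityMeasure μ] (hh : Measurable h) (t : ℝ) :
    ∫⁻ x, (Iic (rearr μ h t)).indicator (fun y => y ^ 2) (h x) ∂μ ≤
      ENNReal.ofReal t * rearr μ h t ^ 2 + ∫⁻ s in Ioo t 1, rearr μ h s ^ 2 := by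
  have hmeas : Measurable fun y : ℝ≥0∞ => y ^ 2 := by fun_prop
  rw [← lintegral_comp_rearr hh (hmeas.indicator measurableSet_Iic)]
  calc _ ≤ ∫⁻ s in Ioc 0 t ∪ Ioo t 1, (Iic (rearr μ h t)).indicator (fun y => y ^ 2) (rearr μ h s) :=
        lintegral_mono_set fun s hs => (le_or_gt s t).imp (fun h => ⟨hs.1, h⟩) fun h => ⟨h, hs.2⟩
    _ ≤ _ := (lintegral_union_le _ _ _).trans ?_
  gcongr ?_ + ?_
  · calc _ ≤ ∫⁻ s in Ioc (0 : ℝ) t, rearr μ h t ^ 2 := by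
          refine lintegral_mono fun s => ?_
          by_cases hle : rearr μ h s ≤ rearr μ h t
          · exact (indicator_le_self _ _ _).trans (pow_le_pow_left₀ zero_le hle 2)
          · rw [indicator_of_notMem (show rearr μ h s ∉ Iic (rearr μ h t) from hle)]
            exact zero_le
      _ = _ := by simp [mul_comm]
  · exact lintegral_mono fun s => indicator_le_self _ _ _

end Rearrangement

section Sequences

variable {a b : ℤ → ℝ≥0∞}

lemma lintegral_Ioi_indicator_lt (x : ℝ≥0∞) :
    ∫⁻ l in Ioi (0 : ℝ), (Iio x).indicator 1 (ENNReal.ofReal l) = x := by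
  have hcomp : (fun l : ℝ => (Iio x).indicator (1 : ℝ≥0∞ → ℝ≥0∞) (ENNReal.ofReal l)) =
      (ENNReal.ofReal ⁻¹' Iio x).indicator 1 := by
    ext l; simp [indicator]
  have hms : MeasurableSet (ENNReal.ofReal ⁻¹' Iio x) :=
    ENNReal.measurable_ofReal measurableSet_Iio
  rw [hcomp, lintegral_indicator_one hms, Measure.restrict_apply hms]
  induction x with
  | top =>
    have : ENNReal.ofReal ⁻¹' Iio ⊤ ∩ Ioi 0 = Ioi (0 : ℝ) := by ext; simp
    rw [this, Real.volume_Ioi]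
  | coe x =>
    have : ENNReal.ofReal ⁻¹' Iio (x : ℝ≥0∞) ∩ Ioi 0 = Ioo (0 : ℝ) x := by
      ext l
      simp only [mem_inter_iff, mem_preimage, mem_Iio, mem_Ioi, mem_Ioo, and_comm (a := 0 < l)]
      refine and_congr_left fun hl => ?_
      rw [ENNReal.ofReal_lt_iff_lt_toReal hl.le coe_ne_top, coe_toReal]
    rw [this, Real.volume_Ioo, sub_zero, ofReal_coe_nnreal]

lemma lt_seqRearr_iff {l : ℝ≥0∞} {j : ℕ} :
    l < seqRearr b j ↔ (j : ℝ≥0∞) < Measure.count {n | l < b n} := by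
  have h : seqRearr b j = rearr Measure.count b (j : ℝ) := by
    simp [seqRearr, rearr]
  rw [h, lt_rearr_iff, ENNReal.ofReal_natCast]

lemma tsum_indicator_natCast_lt_le (x : ℕ∞) :
    ∑' j : ℕ, {j : ℕ | (j : ℝ≥0∞) < (x : ℝ≥0∞)}.indicator (1 : ℕ → ℝ≥0∞) j ≤ x := by
  refine ENNReal.tsum_le_of_sum_range_le fun n => ?_
  induction n with
  | zero => simp
  | succ n ih =>
    rw [Finset.sum_range_succ]
    by_cases hn : (n : ℝ≥0∞) < (x : ℝ≥0∞)
    · have hle : ∑ j ∈ Finset.range n, {j : ℕ | (j : ℝ≥0∞) < (x : ℝ≥0∞)}.indicator (1 : ℕ → ℝ≥0∞) j ≤ n := by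
        refine (Finset.sum_le_card_nsmul _ _ 1 fun j _ => ?_).trans (by simp)
        exact indicator_le_self _ _ _
      rw [indicator_of_mem (show n ∈ {j : ℕ | (j : ℝ≥0∞) < (x : ℝ≥0∞)} from hn), Pi.one_apply]
      refine (add_le_add_left hle _).trans ?_
      have hn' : (n : ℕ∞) < x := by exact_mod_cast hn
      exact_mod_cast Order.add_one_le_of_lt hn'
    · rwa [indicator_of_notMem (show n ∉ {j : ℕ | (j : ℝ≥0∞) < (x : ℝ≥0∞)} from hn), add_zero]

lemma tsum_seqRearr_le : ∑' j, seqRearr b j ≤ ∑' n, b n := by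
  have hmeas (x : ℝ≥0∞) :
      Measurable fun l : ℝ => (Iio x).indicator (1 : ℝ≥0∞ → ℝ≥0∞) (ENNReal.ofReal l) :=
    (measurable_one.indicator measurableSet_Iio).comp ENNReal.measurable_ofReal
  calc ∑' j, seqRearr b j
      = ∫⁻ l in Ioi (0 : ℝ), ∑' j, (Iio (seqRearr b j)).indicator 1 (ENNReal.ofReal l) := by
        rw [lintegral_tsum fun j => (hmeas _).aemeasurable]
        simp_rw [lintegral_Ioi_indicator_lt]
    _ ≤ ∫⁻ l in Ioi (0 : ℝ), ∑' n, (Iio (b n)).indicator 1 (ENNReal.ofReal l) := by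
        refine lintegral_mono fun l => ?_
        have hcount : ∑' n, (Iio (b n)).indicator (1 : ℝ≥0∞ → ℝ≥0∞) (ENNReal.ofReal l) =
            Measure.count {n | ENNReal.ofReal l < b n} := by
          rw [← lintegral_count, ← lintegral_indicator_one .of_discrete]
          rfl
        rw [hcount, Measure.count_apply .of_discrete]
        convert tsum_indicator_natCast_lt_le {n | ENNReal.ofReal l < b n}.encard using 3 with j
        simp only [indicator, mem_Iio, lt_seqRearr_iff, Measure.count_apply .of_discrete,
          Pi.one_apply, mem_ofPred_eq]
    _ = ∑' n, b n := by
        rw [lintegral_tsum fun j => (hmeas _).aemeasurable]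
        simp_rw [lintegral_Ioi_indicator_lt]

lemma seqRearr_sq_le {C D : ℝ≥0∞} (h : ∀ n, a n ^ 2 ≤ C + D * b n) (j : ℕ) : seqRearr a j ^ 2 ≤ C + D * seqRearr b j := by
  by_contra! hlt
  have hsq (x : ℝ≥0∞) : (x ^ (1 / 2 : ℝ)) ^ 2 = x := by
    rw [← ENNReal.rpow_natCast, ← ENNReal.rpow_mul]; norm_num
  have hlt' : (C + D * seqRearr b j) ^ (1 / 2 : ℝ) < seqRearr a j := by
    refine lt_of_not_ge fun hle => hlt.not_ge ?_
    rw [← hsq (C + _)]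
    gcongr
  rw [lt_seqRearr_iff] at hlt'
  refine lt_irrefl (seqRearr b j) (lt_seqRearr_iff.2 (hlt'.trans_le (measure_mono fun n hn => ?_)))
  have hn' : C + D * seqRearr b j < C + D * b n := by
    rw [← hsq (C + D * seqRearr b j)]
    exact (ENNReal.pow_lt_pow_left two_ne_zero hn).trans_le (h n)
  exact show seqRearr b j < b n from lt_of_not_ge fun hle => absurd hn' (not_lt.2 (by gcongr))

lemma sum_seqRearr_sq_le {C D : ℝ≥0∞} (h : ∀ n, a n ^ 2 ≤ C + D * b n) (N : ℕ) : ∑ j ∈ Finset.range N, seqRearr a j ^ 2 ≤ N * C + D * ∑' n, b n := by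
  calc _ ≤ ∑ j ∈ Finset.range N, (C + D * seqRearr b j) :=
        Finset.sum_le_sum fun j _ => seqRearr_sq_le h j
    _ = N * C + D * ∑ j ∈ Finset.range N, seqRearr b j := by
        simp [Finset.sum_add_distrib, Finset.mul_sum]
    _ ≤ _ := by
        gcongr
        exact (ENNReal.sum_le_tsum _).trans tsum_seqRearr_le

end Sequences

section Fourier

variable {f : ℝ → ℂ}

lemma enn_eq_enorm {α : Type*} (f : α → ℂ) (x : α) : enn f x = ‖f x‖ₑ := by
  rw [enn, ofReal_norm]

lemma measurable_enn (hf : Measurable f) : Measurable (enn f) := by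
  unfold enn; fun_prop

lemma norm_exp_neg_two_pi_mul (n : ℤ) (x : ℝ) :
    ‖Complex.exp (((-2 * Real.pi * ((n : ℝ) * x) : ℝ) : ℂ) * Complex.I)‖ = 1 :=
  Complex.norm_exp_ofReal_mul_I _

lemma enn_fc_le (f : ℝ → ℂ) (n : ℤ) : enn (fc f) n ≤ ∫⁻ x in Ico (0 : ℝ) 1, enn f x := by
  rw [enn_eq_enorm, fc]
  refine (enorm_integral_le_lintegral_enorm _).trans_eq ?_
  refine lintegral_congr fun x => ?_
  rw [enn_eq_enorm, enorm_mul, ← ofReal_norm (Complex.exp _), norm_exp_neg_two_pi_mul,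
    ENNReal.ofReal_one, mul_one]

lemma fc_indicator_add_compl (hf : IntegrableOn f (Ico 0 1)) {A : Set ℝ} (hA : MeasurableSet A)
    (n : ℤ) : fc f n = fc (A.indicator f) n + fc (Aᶜ.indicator f) n := by
  have hint {g : ℝ → ℂ} (hg : IntegrableOn g (Ico 0 1)) : IntegrableOn (fun x =>
      g x * Complex.exp (((-2 * Real.pi * ((n : ℝ) * x) : ℝ) : ℂ) * Complex.I)) (Ico 0 1) := by
    refine hg.mul_bdd (c := 1) ?_ (.of_forall fun x => (norm_exp_neg_two_pi_mul n x).le)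
    exact (by fun_prop : Continuous fun x : ℝ => Complex.exp
      (((-2 * Real.pi * ((n : ℝ) * x) : ℝ) : ℂ) * Complex.I)).aestronglyMeasurable
  rw [fc, fc, fc, ← integral_add (hint (hf.indicator hA)) (hint (hf.indicator hA.compl))]
  refine integral_congr_ae (.of_forall fun x => ?_)
  simp only [← add_mul, indicator_self_add_compl_apply]

lemma fc_eq_fourierCoeffOn (f : ℝ → ℂ) (n : ℤ) :
    fc f n = fourierCoeffOn (zero_lt_one' ℝ) f n := by
  rw [fourierCoeffOn_eq_integral, fc, integral_Ico_eq_integral_Ioc,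
    intervalIntegral.integral_of_le zero_le_one, sub_zero, div_one, one_smul]
  refine integral_congr_ae (.of_forall fun x => ?_)
  simp only [fourier_coe_apply, smul_eq_mul]
  rw [mul_comm]
  congr 2
  push_cast
  ring

lemma tsum_enn_fc_sq_le (hf : Measurable f) :
    ∑' n, enn (fc f) n ^ 2 ≤ ∫⁻ x in Ico (0 : ℝ) 1, enn f x ^ 2 := by
  by_cases htop : ∫⁻ x in Ico (0 : ℝ) 1, enn f x ^ 2 = ⊤
  · simp [htop]
  rw [setLIntegral_congr Ico_ae_eq_Ioc] at htop ⊢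
  have hL2 : MemLp f 2 (volume.restrict (Ioc 0 1)) := by
    refine ⟨hf.aestronglyMeasurable, ?_⟩
    rw [eLpNorm_lt_top_iff_lintegral_rpow_enorm_lt_top two_ne_zero ofNat_ne_top]
    simpa [enn_eq_enorm, lt_top_iff_ne_top] using htop
  have hsum := hasSum_sq_fourierCoeffOn (zero_lt_one' ℝ) hL2
  have hsq (z : ℂ) : ENNReal.ofReal ‖z‖ ^ 2 = ENNReal.ofReal (‖z‖ ^ 2) :=
    (ENNReal.ofReal_pow (norm_nonneg _) 2).symm
  simp only [enn, hsq, fc_eq_fourierCoeffOn]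
  rw [← ENNReal.ofReal_tsum_of_nonneg (fun n => by positivity) hsum.summable, hsum.tsum_eq,
    intervalIntegral.integral_of_le zero_le_one, sub_zero, inv_one, one_smul,
    ofReal_integral_eq_lintegral_ofReal hL2.norm.integrable_sq (.of_forall fun x => by positivity)]

lemma sum_seqRearr_fc_sq_le (hf : Measurable f) (hfi : IntegrableOn f (Ico 0 1)) (t : ℝ) (N : ℕ) :
    ∑ j ∈ Finset.range N, seqRearr (enn (fc f)) j ^ 2 ≤
      N * (2 * (∫⁻ s in Ioo 0 t, circRearr f s) ^ 2) +
        2 * (ENNReal.ofReal t * circRearr f t ^ 2 + ∫⁻ s in Ioo t 1, circRearr f s ^ 2) := by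
  have : IsProbabilityMeasure (volume.restrict (Ico (0 : ℝ) 1)) := ⟨by simp⟩
  have hm := measurable_enn hf
  let A : Set ℝ := {x | circRearr f t < enn f x}
  have hA : MeasurableSet A := measurableSet_lt measurable_const hm
  have hlarge : ∫⁻ x in Ico (0 : ℝ) 1, enn (A.indicator f) x ≤ ∫⁻ s in Ioo 0 t, circRearr f s := by
    refine le_trans (le_of_eq (lintegral_congr fun x => ?_))
      (lintegral_indicator_gt_rearr_le hm t)
    by_cases hx : circRearr f t < enn f x
    · rw [indicator_of_mem (show enn f x ∈ Ioi (rearr _ _ t) from hx), enn,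
        indicator_of_mem (show x ∈ A from hx)]
      rfl
    · rw [indicator_of_notMem (show enn f x ∉ Ioi (rearr _ _ t) from hx), enn,
        indicator_of_notMem (show x ∉ A from hx)]
      simp
  have hsmall : ∫⁻ x in Ico (0 : ℝ) 1, enn (Aᶜ.indicator f) x ^ 2 ≤
      ENNReal.ofReal t * circRearr f t ^ 2 + ∫⁻ s in Ioo t 1, circRearr f s ^ 2 := by
    refine le_trans (le_of_eq (lintegral_congr fun x => ?_))
      (lintegral_indicator_le_rearr_sq_le hm t)
    by_cases hx : enn f x ≤ circRearr f t
    · rw [indicator_of_mem (show enn f x ∈ Iic (rearr _ _ t) from hx), enn,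
        indicator_of_mem (show x ∈ Aᶜ from not_lt.2 hx)]
      rfl
    · rw [indicator_of_notMem (show enn f x ∉ Iic (rearr _ _ t) from hx), enn,
        indicator_of_notMem (show x ∉ Aᶜ from fun h => hx (not_lt.1 h))]
      simp
  have hsplit (n : ℤ) : enn (fc f) n ^ 2 ≤ 2 * (∫⁻ s in Ioo 0 t, circRearr f s) ^ 2 +
      2 * enn (fc (Aᶜ.indicator f)) n ^ 2 := by
    have hle : enn (fc f) n ≤ (∫⁻ s in Ioo 0 t, circRearr f s) + enn (fc (Aᶜ.indicator f)) n := by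
      calc enn (fc f) n ≤ enn (fc (A.indicator f)) n + enn (fc (Aᶜ.indicator f)) n := by
            simp only [enn_eq_enorm]
            rw [fc_indicator_add_compl hfi hA n]
            exact enorm_add_le _ _
        _ ≤ _ := by
            gcongr
            exact (enn_fc_le _ n).trans hlarge
    refine (ENNReal.pow_le_pow_left hle).trans ?_
    have := ENNReal.rpow_add_le_mul_rpow_add_rpow (∫⁻ s in Ioo 0 t, circRearr f s)
      (enn (fc (Aᶜ.indicator f)) n) one_le_two
    norm_num at this
    simpa [mul_add] using this
  refine (sum_seqRearr_sq_le hsplit N).trans ?_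
  gcongr
  exact (tsum_enn_fc_sq_le (hf.indicator hA.compl)).trans hsmall

end Fourier

section Hardy

variable {g : ℝ → ℝ≥0∞} {q : ℝ}

lemma lintegral_Ioo_rpow {a u : ℝ} (ha : -1 < a) (hu : 0 < u) :
    ∫⁻ r in Ioo 0 u, ENNReal.ofReal (r ^ a) = ENNReal.ofReal (u ^ (a + 1) / (a + 1)) := by
  rw [setLIntegral_congr Ioo_ae_eq_Ioc, ← ofReal_integral_eq_lintegral_ofReal,
    ← intervalIntegral.integral_of_le hu.le, integral_rpow (Or.inl ha),
    Real.zero_rpow (by linarith), sub_zero]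
  · exact (intervalIntegrable_iff_integrableOn_Ioc_of_le hu.le).1
      (intervalIntegral.intervalIntegrable_rpow' ha)
  · filter_upwards [ae_restrict_mem measurableSet_Ioc] with r hr
    exact Real.rpow_nonneg hr.1.le _

lemma lintegral_Ioi_rpow {a r : ℝ} (ha : a < -1) (hr : 0 < r) :
    ∫⁻ u in Ioi r, ENNReal.ofReal (u ^ a) = ENNReal.ofReal (-r ^ (a + 1) / (a + 1)) := by
  rw [← ofReal_integral_eq_lintegral_ofReal (integrableOn_Ioi_rpow_of_lt ha hr),
    integral_Ioi_rpow_of_lt ha hr]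
  filter_upwards [ae_restrict_mem measurableSet_Ioi] with u hu
  exact Real.rpow_nonneg (hr.trans hu).le _

lemma lintegral_Ioo_rpow_le (hq : 1 < q) (hg : Measurable g) {u : ℝ} (hu : 0 < u) :
    (∫⁻ r in Ioo 0 u, g r) ^ q ≤
      ENNReal.ofReal ((u ^ (1 - q⁻¹) / (1 - q⁻¹)) ^ (q - 1)) *
        ∫⁻ r in Ioo 0 u, g r ^ q * ENNReal.ofReal (r ^ (1 - q⁻¹)) := by
  have hq0 : 0 < q := by linarith
  have hq1 : 0 < q - 1 := by linarith
  have he : 0 < 1 - q⁻¹ := sub_pos.2 (inv_lt_one_of_one_lt₀ hq)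
  set e := 1 - q⁻¹ with he_def
  have hconj : q.HolderConjugate e⁻¹ := Real.holderConjugate_iff.2 ⟨hq, by rw [inv_inv]; ring⟩
  have hholder := ENNReal.lintegral_mul_le_Lp_mul_Lq (volume.restrict (Ioo 0 u)) hconj
    (f := fun r => g r * ENNReal.ofReal (r ^ (e / q))) (g := fun r => ENNReal.ofReal (r ^ (-e / q)))
    (by fun_prop) (by fun_prop)
  have h1 : ∫⁻ r in Ioo 0 u, ((fun r => g r * ENNReal.ofReal (r ^ (e / q))) *
      fun r => ENNReal.ofReal (r ^ (-e / q))) r = ∫⁻ r in Ioo 0 u, g r := by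
    refine setLIntegral_congr_fun measurableSet_Ioo fun r hr => ?_
    have hr0 : 0 < r := hr.1
    simp only [Pi.mul_apply]
    rw [mul_assoc, ← ENNReal.ofReal_mul (by positivity), ← Real.rpow_add hr0, neg_div,
      add_neg_cancel, Real.rpow_zero, ENNReal.ofReal_one, mul_one]
  have h2 : ∫⁻ r in Ioo 0 u, (g r * ENNReal.ofReal (r ^ (e / q))) ^ q =
      ∫⁻ r in Ioo 0 u, g r ^ q * ENNReal.ofReal (r ^ e) := by
    refine setLIntegral_congr_fun measurableSet_Ioo fun r hr => ?_
    have hr0 : 0 < r := hr.1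
    rw [ENNReal.mul_rpow_of_nonneg _ _ hq0.le, ENNReal.ofReal_rpow_of_nonneg (by positivity) hq0.le,
      ← Real.rpow_mul hr0.le, div_mul_cancel₀ _ hq0.ne']
  have h3 : ∫⁻ r in Ioo 0 u, ENNReal.ofReal (r ^ (-e / q)) ^ e⁻¹ =
      ENNReal.ofReal (u ^ e / e) := by
    have hexp : -q⁻¹ + 1 = e := by rw [he_def]; ring
    have hint := lintegral_Ioo_rpow (a := -q⁻¹) (by linarith) hu
    rw [hexp] at hint
    rw [← hint]
    refine setLIntegral_congr_fun measurableSet_Ioo fun r hr => ?_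
    have hr0 : 0 < r := hr.1
    rw [ENNReal.ofReal_rpow_of_nonneg (by positivity) (by positivity), ← Real.rpow_mul hr0.le]
    congr 2
    field_simp
  rw [h1, h2, h3] at hholder
  refine (ENNReal.rpow_le_rpow hholder hq0.le).trans_eq ?_
  rw [ENNReal.mul_rpow_of_nonneg _ _ hq0.le, ← ENNReal.rpow_mul, ← ENNReal.rpow_mul,
    one_div_mul_cancel hq0.ne', ENNReal.rpow_one, mul_comm,
    ENNReal.ofReal_rpow_of_nonneg (by positivity) (by positivity)]
  congr 3
  rw [he_def]
  field_simp

lemma hardy_lintegral (hq : 1 < q) (hg : Measurable g) :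
    ∫⁻ u in Ioi (0 : ℝ), ((ENNReal.ofReal u)⁻¹ * ∫⁻ r in Ioo 0 u, g r) ^ q ≤
      ENNReal.ofReal ((1 - q⁻¹) ^ (-q)) * ∫⁻ u in Ioi (0 : ℝ), g u ^ q := by
  have hq0 : 0 < q := by linarith
  have hq1 : 0 < q - 1 := by linarith
  have he : 0 < 1 - q⁻¹ := sub_pos.2 (inv_lt_one_of_one_lt₀ hq)
  set e := 1 - q⁻¹ with he_def
  set F : ℝ → ℝ → ℝ≥0∞ := fun u r => (Ioi r).indicator
    (fun u => ENNReal.ofReal (e ^ (1 - q) * u ^ (-1 - e))) u *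
      (g r ^ q * ENNReal.ofReal (r ^ e)) with hF
  have hFm : Measurable (Function.uncurry F) := by
    have hind : Measurable ({z : ℝ × ℝ | z.2 < z.1}.indicator
        fun z => ENNReal.ofReal (e ^ (1 - q) * z.1 ^ (-1 - e))) :=
      Measurable.indicator (by fun_prop) (measurableSet_lt measurable_snd measurable_fst)
    have hsnd : Measurable fun z : ℝ × ℝ => g z.2 ^ q * ENNReal.ofReal (z.2 ^ e) := by fun_prop
    exact hind.mul hsnd
  calc ∫⁻ u in Ioi (0 : ℝ), ((ENNReal.ofReal u)⁻¹ * ∫⁻ r in Ioo 0 u, g r) ^ q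
      ≤ ∫⁻ u in Ioi (0 : ℝ), ∫⁻ r in Ioi (0 : ℝ), F u r := by
        refine setLIntegral_mono' measurableSet_Ioi fun u (hu : 0 < u) => ?_
        rw [ENNReal.mul_rpow_of_nonneg _ _ hq0.le, ← ENNReal.ofReal_inv_of_pos hu,
          ENNReal.ofReal_rpow_of_nonneg (by positivity) hq0.le]
        refine (mul_le_mul_right (lintegral_Ioo_rpow_le hq hg hu) _).trans_eq ?_
        have hconst : u⁻¹ ^ q * (u ^ e / e) ^ (q - 1) = e ^ (1 - q) * u ^ (-1 - e) := by
          rw [Real.inv_rpow hu.le, ← Real.rpow_neg hu.le, Real.div_rpow (by positivity) he.le,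
            ← Real.rpow_mul hu.le, div_eq_mul_inv, ← Real.rpow_neg he.le, ← mul_assoc,
            ← Real.rpow_add hu, mul_comm, neg_sub]
          congr 2
          rw [he_def]
          field_simp
          ring
        rw [← mul_assoc, ← ENNReal.ofReal_mul (by positivity), ← he_def, hconst,
          ← lintegral_const_mul _ (by fun_prop), ← Ioi_inter_Iio, inter_comm,
          ← Measure.restrict_restrict measurableSet_Iio, ← lintegral_indicator measurableSet_Iio]
        refine lintegral_congr fun r => ?_
        by_cases hr : r < u
        · simp [F, hr]
        · simp [F, hr]
    _ = ∫⁻ r in Ioi (0 : ℝ), ∫⁻ u in Ioi (0 : ℝ), F u r :=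
        lintegral_lintegral_swap hFm.aemeasurable
    _ = ∫⁻ r in Ioi (0 : ℝ), ENNReal.ofReal (e ^ (-q)) * g r ^ q := by
        refine setLIntegral_congr_fun measurableSet_Ioi fun r (hr : 0 < r) => ?_
        simp only [hF]
        rw [lintegral_mul_const _ (Measurable.indicator (by fun_prop) measurableSet_Ioi),
          lintegral_indicator measurableSet_Ioi, Measure.restrict_restrict measurableSet_Ioi,
          inter_eq_self_of_subset_left (Ioi_subset_Ioi hr.le)]
        simp_rw [ENNReal.ofReal_mul (show 0 ≤ e ^ (1 - q) by positivity)]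
        rw [lintegral_const_mul _ (by fun_prop), lintegral_Ioi_rpow (by linarith) hr,
          ← ENNReal.ofReal_mul (by positivity), mul_comm (g r ^ q), ← mul_assoc,
          ← ENNReal.ofReal_mul (by
            rw [show -1 - e + 1 = -e by ring, neg_div_neg_eq]; positivity)]
        congr 2
        rw [show -1 - e + 1 = -e by ring, neg_div_neg_eq, mul_assoc, div_mul_eq_mul_div,
          ← Real.rpow_add hr, neg_add_cancel, Real.rpow_zero, Real.rpow_sub he, Real.rpow_one,
          Real.rpow_neg he.le]
        field_simp
    _ = _ := lintegral_const_mul _ (by fun_prop)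

end Hardy

section Exponential

lemma lintegral_image_exp_neg {s : Set ℝ} (hs : MeasurableSet s) (G : ℝ → ℝ≥0∞) :
    ∫⁻ t in (fun u => Real.exp (-u)) '' s, G t * (ENNReal.ofReal t)⁻¹ =
      ∫⁻ u in s, G (Real.exp (-u)) := by
  have hderiv (u : ℝ) : HasDerivAt (fun u => Real.exp (-u)) (-Real.exp (-u)) u := by
    simpa using (hasDerivAt_neg u).exp
  rw [lintegral_image_eq_lintegral_abs_deriv_mul hs (fun u _ => (hderiv u).hasDerivWithinAt)
    (fun a _ b _ hab => neg_injective (Real.exp_injective hab))]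
  refine lintegral_congr fun u => ?_
  have hpos := Real.exp_pos (-u)
  rw [abs_neg, abs_of_pos hpos, mul_left_comm,
    ENNReal.mul_inv_cancel (ENNReal.ofReal_pos.2 hpos).ne' ofReal_ne_top, mul_one]

lemma image_exp_neg_Ioi : (fun u => Real.exp (-u)) '' Ioi 0 = Ioo 0 1 := by
  ext t
  constructor
  · rintro ⟨u, hu, rfl⟩
    exact ⟨Real.exp_pos _, Real.exp_lt_one_iff.2 (neg_lt_zero.2 hu)⟩
  · rintro ⟨ht0, ht1⟩
    exact ⟨-Real.log t, neg_pos.2 (Real.log_neg ht0 ht1), by simp [Real.exp_log ht0]⟩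

lemma image_exp_neg_Ioo (u : ℝ) :
    (fun u => Real.exp (-u)) '' Ioo 0 u = Ioo (Real.exp (-u)) 1 := by
  ext t
  constructor
  · rintro ⟨v, hv, rfl⟩
    exact ⟨Real.exp_lt_exp.2 (neg_lt_neg hv.2), Real.exp_lt_one_iff.2 (neg_lt_zero.2 hv.1)⟩
  · rintro ⟨ht, ht1⟩
    have ht0 := (Real.exp_pos _).trans ht
    refine ⟨-Real.log t, ⟨neg_pos.2 (Real.log_neg ht0 ht1), ?_⟩, by simp [Real.exp_log ht0]⟩
    exact neg_lt.1 ((Real.lt_log_iff_exp_lt ht0).2 ht)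

end Exponential

section Lorentz

variable {f : ℝ → ℂ}

/-- The function `t f^{**}(t)²` in the logarithmic variable `t = e^{-u}`. -/
def maxRearrSqExp (f : ℝ → ℂ) (u : ℝ) : ℝ≥0∞ :=
  ENNReal.ofReal (Real.exp (-u)) * circMaxRearr f (Real.exp (-u)) ^ 2

lemma measurable_circMaxRearr : Measurable (circMaxRearr f) := by
  have hmono : Monotone fun t => ∫⁻ s in Ioo (0 : ℝ) t, circRearr f s := fun _ _ hst =>
    lintegral_mono_set (Ioo_subset_Ioo_right hst)
  exact ENNReal.measurable_ofReal.inv.mul hmono.measurable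

lemma measurable_maxRearrSqExp : Measurable (maxRearrSqExp f) := by
  have := measurable_circMaxRearr (f := f)
  unfold maxRearrSqExp
  fun_prop

lemma ofReal_mul_circMaxRearr {t : ℝ} (ht : 0 < t) :
    ENNReal.ofReal t * circMaxRearr f t = ∫⁻ s in Ioo (0 : ℝ) t, circRearr f s := by
  rw [circMaxRearr, ← mul_assoc, ENNReal.mul_inv_cancel (ENNReal.ofReal_pos.2 ht).ne' ofReal_ne_top,
    one_mul]

lemma circRearr_le_circMaxRearr {t : ℝ} (ht : 0 < t) : circRearr f t ≤ circMaxRearr f t := by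
  rw [← ENNReal.mul_le_mul_iff_right (ENNReal.ofReal_pos.2 ht).ne' ofReal_ne_top,
    ofReal_mul_circMaxRearr ht]
  calc ENNReal.ofReal t * circRearr f t = ∫⁻ s in Ioo 0 t, circRearr f t := by simp [mul_comm]
    _ ≤ _ := setLIntegral_mono' measurableSet_Ioo fun s hs => rearr_antitone hs.2.le

lemma lorentz2_rpow {p : ℝ} (hp : 0 < p) :
    lorentz2 p f ^ p = ∫⁻ u in Ioi (0 : ℝ), maxRearrSqExp f u ^ (p / 2) := by
  rw [lorentz2, ← ENNReal.rpow_mul, one_div_mul_cancel hp.ne', ENNReal.rpow_one,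
    ← image_exp_neg_Ioi, lintegral_image_exp_neg measurableSet_Ioi]
  refine lintegral_congr fun u => ?_
  have hpos := Real.exp_pos (-u)
  rw [maxRearrSqExp, ← ENNReal.ofReal_rpow_of_pos hpos, ENNReal.mul_rpow_of_nonneg _ _ hp.le,
    ENNReal.mul_rpow_of_nonneg _ _ (by positivity), ← ENNReal.rpow_mul, ← ENNReal.rpow_natCast,
    ← ENNReal.rpow_mul]
  congr 2 <;> push_cast <;> ring

lemma sum_seqRearr_fc_sq_le_maxRearrSqExp (hf : Measurable f) (hfi : IntegrableOn f (Ico 0 1))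
    {N : ℕ} {u : ℝ} (hN : N ≤ Real.exp u) :
    ∑ j ∈ Finset.range N, seqRearr (enn (fc f)) j ^ 2 ≤
      4 * maxRearrSqExp f u + 2 * ∫⁻ v in Ioo 0 u, maxRearrSqExp f v := by
  refine (sum_seqRearr_fc_sq_le hf hfi (Real.exp (-u)) N).trans ?_
  have hpos := Real.exp_pos (-u)
  have h1 : N * (∫⁻ s in Ioo 0 (Real.exp (-u)), circRearr f s) ^ 2 ≤ maxRearrSqExp f u := by
    rw [← ofReal_mul_circMaxRearr hpos, mul_pow, sq (ENNReal.ofReal _), mul_assoc, ← mul_assoc,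
      maxRearrSqExp]
    refine mul_le_of_le_one_left zero_le ?_
    rw [← ENNReal.ofReal_natCast, ← ENNReal.ofReal_mul (by positivity), ENNReal.ofReal_le_one,
      Real.exp_neg]
    exact mul_inv_le_one_of_le₀ hN (Real.exp_pos u).le
  have h2 : ENNReal.ofReal (Real.exp (-u)) * circRearr f (Real.exp (-u)) ^ 2 ≤
      maxRearrSqExp f u := by
    unfold maxRearrSqExp
    gcongr
    exact circRearr_le_circMaxRearr hpos
  have h3 : ∫⁻ s in Ioo (Real.exp (-u)) 1, circRearr f s ^ 2 ≤
      ∫⁻ v in Ioo 0 u, maxRearrSqExp f v := by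
    unfold maxRearrSqExp
    rw [← lintegral_image_exp_neg measurableSet_Ioo
      (fun t => ENNReal.ofReal t * circMaxRearr f t ^ 2), image_exp_neg_Ioo]
    refine setLIntegral_mono' measurableSet_Ioo fun s hs => ?_
    have hs0 := hpos.trans hs.1
    rw [mul_right_comm, ENNReal.mul_inv_cancel (ENNReal.ofReal_pos.2 hs0).ne' ofReal_ne_top,
      one_mul]
    gcongr
    exact circRearr_le_circMaxRearr hs0
  calc _ = 2 * (N * (∫⁻ s in Ioo 0 (Real.exp (-u)), circRearr f s) ^ 2) +
        2 * (ENNReal.ofReal (Real.exp (-u)) * circRearr f (Real.exp (-u)) ^ 2 +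
          ∫⁻ s in Ioo (Real.exp (-u)) 1, circRearr f s ^ 2) := by rw [mul_left_comm]
    _ ≤ 2 * maxRearrSqExp f u + 2 * (maxRearrSqExp f u + ∫⁻ v in Ioo 0 u, maxRearrSqExp f v) := by
        gcongr
    _ = _ := by ring

lemma inv_le_two_mul_volume_Ioo_log (n : ℕ) :
    (ENNReal.ofReal ((n : ℝ) + 1))⁻¹ ≤
      2 * volume (Ioo (Real.log ((n : ℝ) + 1)) (Real.log ((n : ℝ) + 2))) := by
  have hn : (0 : ℝ) < n + 1 := by positivity
  have hn2 : (0 : ℝ) < n + 2 := by positivity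
  rw [Real.volume_Ioo, ← ENNReal.ofReal_inv_of_pos hn, ← ENNReal.ofReal_ofNat 2,
    ← ENNReal.ofReal_mul zero_le_two]
  refine ENNReal.ofReal_le_ofReal ?_
  have hlog := Real.log_le_sub_one_of_pos (div_pos hn hn2)
  rw [Real.log_div hn.ne' hn2.ne'] at hlog
  have hfrac : ((n : ℝ) + 1)⁻¹ ≤ 2 * (1 - (n + 1) / (n + 2)) := by
    rw [one_sub_div hn2.ne', inv_eq_one_div, ← mul_div_assoc, div_le_div_iff₀ hn hn2]
    nlinarith
  linarith

lemma sum_rpow_mul_inv_le_lintegral {q : ℝ} (hq : 1 < q) (hf : Measurable f)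
    (hfi : IntegrableOn f (Ico 0 1)) (n : ℕ) :
    (∑ j ∈ Finset.range (n + 1), seqRearr (enn (fc f)) j ^ (2 : ℝ)) ^ q *
        (ENNReal.ofReal (((n : ℝ) + 1) * Real.log ((n : ℝ) + 2) ^ q))⁻¹ ≤
      2 * ∫⁻ u in Ioo (Real.log ((n : ℝ) + 1)) (Real.log ((n : ℝ) + 2)),
        (4 * ENNReal.ofReal (Real.log 2)⁻¹ * maxRearrSqExp f u +
          2 * ((ENNReal.ofReal u)⁻¹ * ∫⁻ v in Ioo 0 u, maxRearrSqExp f v)) ^ q := by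
  have hq0 : 0 < q := by linarith
  have hn : (0 : ℝ) < n + 1 := by positivity
  have hlog2 : Real.log 2 ≤ Real.log (n + 2) := Real.log_le_log two_pos (by linarith)
  have hlog2_pos : 0 < Real.log 2 := Real.log_pos one_lt_two
  have hL : 0 < Real.log (n + 2) := hlog2_pos.trans_le hlog2
  set L := Real.log ((n : ℝ) + 2)
  set S := ∑ j ∈ Finset.range (n + 1), seqRearr (enn (fc f)) j ^ (2 : ℝ)
  have hsplit : S ^ q * (ENNReal.ofReal (((n : ℝ) + 1) * L ^ q))⁻¹ =
      (ENNReal.ofReal (n + 1))⁻¹ * (S * ENNReal.ofReal L⁻¹) ^ q := by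
    rw [ENNReal.mul_rpow_of_nonneg _ _ hq0.le, ENNReal.ofReal_rpow_of_nonneg (by positivity) hq0.le,
      Real.inv_rpow hL.le, ENNReal.ofReal_inv_of_pos (by positivity), ENNReal.ofReal_mul hn.le,
      ENNReal.mul_inv (Or.inr ofReal_ne_top) (Or.inl ofReal_ne_top)]
    ring
  rw [hsplit]
  calc _ ≤ 2 * volume (Ioo (Real.log ((n : ℝ) + 1)) L) * (S * ENNReal.ofReal L⁻¹) ^ q := by
        gcongr
        exact inv_le_two_mul_volume_Ioo_log n
    _ = 2 * ∫⁻ u in Ioo (Real.log ((n : ℝ) + 1)) L, (S * ENNReal.ofReal L⁻¹) ^ q := by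
        rw [setLIntegral_const, mul_assoc, mul_comm (volume _)]
    _ ≤ _ := by
        refine mul_le_mul_right (setLIntegral_mono' measurableSet_Ioo fun u hu => ?_) 2
        have hu0 : 0 < u := (Real.log_nonneg (by linarith [n.cast_nonneg (α := ℝ)])).trans_lt hu.1
        have hN : ((n + 1 : ℕ) : ℝ) ≤ Real.exp u := by
          push_cast
          exact ((Real.log_lt_iff_lt_exp hn).1 hu.1).le
        have hSle := sum_seqRearr_fc_sq_le_maxRearrSqExp hf hfi hN
        simp only [← ENNReal.rpow_two] at hSle
        have hLu : ENNReal.ofReal L⁻¹ ≤ (ENNReal.ofReal u)⁻¹ := by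
          rw [ENNReal.ofReal_inv_of_pos hL]
          gcongr
          exact hu.2.le
        gcongr
        calc S * ENNReal.ofReal L⁻¹
            ≤ (4 * maxRearrSqExp f u + 2 * ∫⁻ v in Ioo 0 u, maxRearrSqExp f v) *
                ENNReal.ofReal L⁻¹ := by gcongr
          _ = 4 * ENNReal.ofReal L⁻¹ * maxRearrSqExp f u +
                2 * (ENNReal.ofReal L⁻¹ * ∫⁻ v in Ioo 0 u, maxRearrSqExp f v) := by ring
          _ ≤ _ := by gcongr

lemma tsum_rpow_mul_inv_le {q : ℝ} (hq : 1 < q) (hf : Measurable f)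
    (hfi : IntegrableOn f (Ico 0 1)) :
    ∑' n : ℕ, (∑ j ∈ Finset.range (n + 1), seqRearr (enn (fc f)) j ^ (2 : ℝ)) ^ q *
        (ENNReal.ofReal (((n : ℝ) + 1) * Real.log ((n : ℝ) + 2) ^ q))⁻¹ ≤
      2 * (2 ^ (q - 1) * ((4 * ENNReal.ofReal (Real.log 2)⁻¹) ^ q +
        2 ^ q * ENNReal.ofReal ((1 - q⁻¹) ^ (-q)))) *
          ∫⁻ u in Ioi (0 : ℝ), maxRearrSqExp f u ^ q := by
  have hq0 : 0 < q := by linarith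
  have hψ := measurable_maxRearrSqExp (f := f)
  set c := 4 * ENNReal.ofReal (Real.log 2)⁻¹
  set H : ℝ → ℝ≥0∞ := fun u => (ENNReal.ofReal u)⁻¹ * ∫⁻ v in Ioo 0 u, maxRearrSqExp f v
  have hdisj : Pairwise (Function.onFun Disjoint fun n : ℕ =>
      Ioo (Real.log ((n : ℝ) + 1)) (Real.log ((n : ℝ) + 2))) := by
    have hmono : Monotone fun n : ℕ => Real.log ((n : ℝ) + 1) := fun m n hmn =>
      Real.log_le_log (by positivity) (by gcongr)
    convert hmono.pairwise_disjoint_on_Ioo_succ using 5 with n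
    simp [add_assoc, one_add_one_eq_two]
  calc _ ≤ ∑' n : ℕ, 2 * ∫⁻ u in Ioo (Real.log ((n : ℝ) + 1)) (Real.log ((n : ℝ) + 2)),
        (c * maxRearrSqExp f u + 2 * H u) ^ q :=
        ENNReal.tsum_le_tsum fun n => sum_rpow_mul_inv_le_lintegral hq hf hfi n
    _ = 2 * ∫⁻ u in ⋃ n : ℕ, Ioo (Real.log ((n : ℝ) + 1)) (Real.log ((n : ℝ) + 2)),
        (c * maxRearrSqExp f u + 2 * H u) ^ q := by
        rw [ENNReal.tsum_mul_left, lintegral_iUnion (fun _ => measurableSet_Ioo) hdisj]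
    _ ≤ 2 * ∫⁻ u in Ioi (0 : ℝ),
        2 ^ (q - 1) * (c ^ q * maxRearrSqExp f u ^ q + 2 ^ q * H u ^ q) := by
        gcongr 2 * ?_
        refine (lintegral_mono_set (iUnion_subset fun n u hu => ?_)).trans
          (lintegral_mono fun u => ?_)
        · exact (Real.log_nonneg (by linarith [n.cast_nonneg (α := ℝ)])).trans_lt hu.1
        · rw [← ENNReal.mul_rpow_of_nonneg _ _ hq0.le, ← ENNReal.mul_rpow_of_nonneg _ _ hq0.le]
          exact ENNReal.rpow_add_le_mul_rpow_add_rpow _ _ hq.le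
    _ = 2 * (2 ^ (q - 1) * (c ^ q * (∫⁻ u in Ioi (0 : ℝ), maxRearrSqExp f u ^ q) +
          2 ^ q * ∫⁻ u in Ioi (0 : ℝ), H u ^ q)) := by
        rw [lintegral_const_mul' _ _ (by simp), lintegral_add_left (by fun_prop),
          lintegral_const_mul _ (by fun_prop), lintegral_const_mul' _ _ (by simp)]
    _ ≤ 2 * (2 ^ (q - 1) * (c ^ q * (∫⁻ u in Ioi (0 : ℝ), maxRearrSqExp f u ^ q) +
          2 ^ q * (ENNReal.ofReal ((1 - q⁻¹) ^ (-q)) *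
            ∫⁻ u in Ioi (0 : ℝ), maxRearrSqExp f u ^ q))) := by
        gcongr
        exact hardy_lintegral hq hψ
    _ = _ := by ring

end Lorentz

/-- For `2 < p < ∞`, the Fourier coefficients of `f ∈ L^{2,p}(𝕋)` satisfy
`(∑_n (∑_{j≤n} b_j^{*2})^{p/2} (n log^{p/2}(n+1))⁻¹)^{1/p} ≲_p ‖f‖_{L^{2,p}}`. -/
theorem statement18 (p : ℝ) (hp : 2 < p) :
    ∃ K : ℝ≥0∞, 0 < K ∧ K < ∞ ∧
      ∀ f : ℝ → ℂ, Measurable f → IntegrableOn f (Ico (0:ℝ) 1) →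
        (∑' n : ℕ,
            (∑ j ∈ Finset.range (n + 1), seqRearr (enn (fc f)) j ^ (2:ℝ)) ^ (p / 2) *
              (ENNReal.ofReal (((n : ℝ) + 1) * Real.log ((n : ℝ) + 2) ^ (p / 2)))⁻¹) ^ (1 / p) ≤
          K * lorentz2 p f := by
  have hp0 : 0 < p := by linarith
  have hq : 1 < p / 2 := by linarith
  have hq0 : 0 ≤ p / 2 := by linarith
  set C : ℝ≥0∞ := 2 * (2 ^ (p / 2 - 1) * ((4 * ENNReal.ofReal (Real.log 2)⁻¹) ^ (p / 2) +
    2 ^ (p / 2) * ENNReal.ofReal ((1 - (p / 2)⁻¹) ^ (-(p / 2)))))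
  have hC_top : C ≠ ⊤ := by
    have h2 (r : ℝ) : (2 : ℝ≥0∞) ^ r ≠ ⊤ := by simp
    exact mul_ne_top ofNat_ne_top (mul_ne_top (h2 _) (add_ne_top.2
      ⟨rpow_ne_top_of_nonneg hq0 (mul_ne_top ofNat_ne_top ofReal_ne_top),
        mul_ne_top (h2 _) ofReal_ne_top⟩))
  refine ⟨C ^ (1 / p) + 1, by simp, ?_, fun f hf hfi => ?_⟩
  · exact add_lt_top.2 ⟨rpow_lt_top_of_nonneg (by positivity) hC_top, one_lt_top⟩
  · calc _ ≤ (C * lorentz2 p f ^ p) ^ (1 / p) := by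
          rw [lorentz2_rpow hp0]
          exact ENNReal.rpow_le_rpow (tsum_rpow_mul_inv_le hq hf hfi) (by positivity)
      _ = C ^ (1 / p) * lorentz2 p f := by
          rw [ENNReal.mul_rpow_of_nonneg _ _ (by positivity), ← ENNReal.rpow_mul,
            mul_one_div_cancel hp0.ne', ENNReal.rpow_one]
      _ ≤ _ := by gcongr; exact le_self_add
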